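/- Let R be a commutative ring and let j : ℕ → R be any sequence. For n ≥ 1 let J_n(j̄) be the n×n matrix over R whose entry in row i and column k (1 ≤ i,k ≤ n) equals j_{i-k+1} if k ≤ i, equals -(i·1_R) if k = i+1, and equals 0 if k > i+1; set det(J_0(j̄)) = 1. Then in R[x] one has det(J_n(j̄) - x·I_n) = Σ_{r=0}^{n} C(n,r) · det(J_r(j̄)) · (-1)^{n-r} · x^{n-r}. -/

import Mathlib

open Polynomial

/-- The matrix `J_n(j̄)`: entries `j (i - k + 1)` in (1-based) row `i`, column `k` for
`k ≤ i`, superdiagonal entry `-i` in row `i`, column `i + 1`, and `0` above the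
superdiagonal. For `n = 0` this is the empty matrix, whose determinant is `1`. -/
def Jmat {R : Type*} [CommRing R] (j : ℕ → R) (n : ℕ) : Matrix (Fin n) (Fin n) R :=
  Matrix.of fun i k =>
    if (k : ℕ) ≤ (i : ℕ) then j ((i : ℕ) - (k : ℕ) + 1)
    else if (k : ℕ) = (i : ℕ) + 1 then -(((i : ℕ) + 1 : ℕ) : R)
    else 0

/-- Expansion along the last column of a lower Hessenberg matrix with a free last row `v`. -/
lemma det_hessenberg_lastRow_succ {R : Type*} [CommRing R] (a : ℕ → ℕ → R)
    (ha : ∀ i k, i + 1 < k → a i k = 0) (v : ℕ → R) (n : ℕ) :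
    (Matrix.of fun i k : Fin (n + 2) => if (i : ℕ) = n + 1 then v k else a i k).det =
      v (n + 1) * (Matrix.of fun i k : Fin (n + 1) => a i k).det -
        a n (n + 1) *
          (Matrix.of fun i k : Fin (n + 1) => if (i : ℕ) = n then v k else a i k).det := by
  rw [Matrix.det_succ_column _ (Fin.last (n + 1)), Fin.sum_univ_castSucc, Fin.sum_univ_castSucc,
    Finset.sum_eq_zero]
  · have h₁ : (Matrix.of fun i k : Fin (n + 2) => if (i : ℕ) = n + 1 then v k else a i k).submatrix
        (Fin.last (n + 1)).succAbove (Fin.last (n + 1)).succAbove =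
        Matrix.of fun i k : Fin (n + 1) => a i k := by
      ext i k
      simp [i.isLt.ne]
    have h₂ : (Matrix.of fun i k : Fin (n + 2) => if (i : ℕ) = n + 1 then v k else a i k).submatrix
        (Fin.last n).castSucc.succAbove (Fin.last (n + 1)).succAbove =
        Matrix.of fun i k : Fin (n + 1) => if (i : ℕ) = n then v k else a i k := by
      ext i k
      induction i using Fin.lastCases with
      | last => simp
      | cast i =>
        have hi : (Fin.last n).castSucc.succAbove i.castSucc = i.castSucc.castSucc :=
          Fin.succAbove_of_castSucc_lt _ _ (by simp [Fin.lt_def])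
        have h₃ : (i : ℕ) ≠ n + 1 := by omega
        have h₄ : (i : ℕ) ≠ n := by omega
        simp [hi, h₃, h₄]
    rw [h₁, h₂]
    have e₁ : (-1 : R) ^ (n + (n + 1)) = -1 := Odd.neg_one_pow ⟨n, by ring⟩
    have e₂ : (-1 : R) ^ (n + 1 + (n + 1)) = 1 := Even.neg_one_pow ⟨n + 1, rfl⟩
    simp [e₁, e₂]
    ring
  · intro i _
    have h : (i : ℕ) ≠ n + 1 := by omega
    simp [h, ha i (n + 1) (by omega)]

/-- The entries of `Jmat j n`, indexed by natural numbers. -/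
def jmatEntry {R : Type*} [CommRing R] (j : ℕ → R) (i k : ℕ) : R :=
  if k ≤ i then j (i - k + 1) else if k = i + 1 then -((i + 1 : ℕ) : R) else 0

lemma det_jmatEntry_lastRow {R : Type*} [CommRing R] (j v : ℕ → R) (n : ℕ) :
    (Matrix.of fun i k : Fin (n + 1) => if (i : ℕ) = n then v k else jmatEntry j i k).det =
      ∑ k ∈ Finset.range (n + 1), n.descFactorial k • (v (n - k) * (Jmat j (n - k)).det) := by
  induction n with
  | zero => simp
  | succ n ih =>
    rw [det_hessenberg_lastRow_succ _ (fun i k h => by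
      rw [jmatEntry, if_neg (by omega), if_neg (by omega)]), ih, Finset.sum_range_succ' _ (n + 1)]
    have h : jmatEntry j n (n + 1) = -((n + 1 : ℕ) : R) := by simp [jmatEntry]
    rw [h, neg_mul, sub_neg_eq_add, add_comm, Finset.mul_sum]
    congr 1
    · refine Finset.sum_congr rfl fun k _ => ?_
      rw [Nat.succ_descFactorial_succ, Nat.add_sub_add_right]
      simp only [nsmul_eq_mul]
      push_cast
      ring
    · simp only [Nat.descFactorial_zero, one_smul, Nat.sub_zero]
      rfl

lemma det_Jmat_succ {R : Type*} [CommRing R] (j : ℕ → R) (n : ℕ) :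
    (Jmat j (n + 1)).det =
      ∑ k ∈ Finset.range (n + 1), n.descFactorial k • (j (k + 1) * (Jmat j (n - k)).det) := by
  have h : Jmat j (n + 1) = Matrix.of fun i k : Fin (n + 1) =>
      if (i : ℕ) = n then j (n - (k : ℕ) + 1) else jmatEntry j i k := by
    ext i k
    by_cases hi : (i : ℕ) = n
    · have hk : k ≤ i := by omega
      simp only [Jmat, Matrix.of_apply, Fin.val_fin_le, if_pos hk, if_pos hi]
      rw [hi]
    · simp [Jmat, jmatEntry, hi]
  rw [h, det_jmatEntry_lastRow j (fun k => j (n - k + 1))]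
  refine Finset.sum_congr rfl fun k hk => ?_
  rw [Nat.sub_sub_self (Finset.mem_range_succ_iff.mp hk)]

lemma choose_mul_descFactorial {n r k : ℕ} (hk : k ≤ r) :
    n.choose r * r.descFactorial k = n.descFactorial k * (n - k).choose (r - k) := by
  rw [Nat.descFactorial_eq_factorial_mul_choose, Nat.descFactorial_eq_factorial_mul_choose,
    mul_left_comm, Nat.choose_mul hk, mul_assoc]

/-- The binomial transform of a sequence satisfying the recurrence of `det_Jmat_succ`
satisfies the same recurrence with an additional term `y`. -/
lemma binomial_transform_succ {R : Type*} [CommRing R] (j d : ℕ → R) (y : R)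
    (hd : ∀ n, d (n + 1) =
      ∑ k ∈ Finset.range (n + 1), n.descFactorial k • (j (k + 1) * d (n - k))) (n : ℕ) :
    ∑ r ∈ Finset.range (n + 2), (n + 1).choose r • (d r * y ^ (n + 1 - r)) =
      y * ∑ r ∈ Finset.range (n + 1), n.choose r • (d r * y ^ (n - r)) +
        ∑ k ∈ Finset.range (n + 1), n.descFactorial k •
          (j (k + 1) * ∑ r ∈ Finset.range (n - k + 1),
            (n - k).choose r • (d r * y ^ (n - k - r))) := by
  have pascal : ∑ r ∈ Finset.range (n + 2), (n + 1).choose r • (d r * y ^ (n + 1 - r)) =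
      y * ∑ r ∈ Finset.range (n + 1), n.choose r • (d r * y ^ (n - r)) +
        ∑ r ∈ Finset.range (n + 1), n.choose r • (d (r + 1) * y ^ (n - r)) := by
    have hy : y * ∑ r ∈ Finset.range (n + 1), n.choose r • (d r * y ^ (n - r)) =
        ∑ r ∈ Finset.range (n + 2), n.choose r • (d r * y ^ (n + 1 - r)) := by
      rw [Finset.sum_range_succ _ (n + 1), Nat.choose_succ_self, zero_smul, add_zero,
        Finset.mul_sum]
      refine Finset.sum_congr rfl fun r hr => ?_
      rw [Nat.succ_sub (Finset.mem_range_succ_iff.mp hr), pow_succ, mul_smul_comm]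
      congr 1
      ring
    rw [hy, Finset.sum_range_succ' _ (n + 1), Finset.sum_range_succ' _ (n + 1)]
    simp only [Nat.choose_succ_succ', add_smul, Finset.sum_add_distrib, Nat.add_sub_add_right,
      Nat.choose_zero_right]
    ring
  rw [pascal]
  congr 1
  simp only [hd, Finset.sum_mul, Finset.mul_sum, Finset.smul_sum]
  rw [Finset.sum_sigma', Finset.sum_sigma']
  refine Finset.sum_bij' (fun p _ => ⟨p.2, p.1 - p.2⟩) (fun p _ => ⟨p.1 + p.2, p.1⟩)
    ?_ ?_ ?_ ?_ ?_
  · rintro ⟨r, k⟩ h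
    simp only [Finset.mem_sigma, Finset.mem_range] at h ⊢
    omega
  · rintro ⟨k, r⟩ h
    simp only [Finset.mem_sigma, Finset.mem_range] at h ⊢
    omega
  · rintro ⟨r, k⟩ h
    simp only [Finset.mem_sigma, Finset.mem_range] at h
    simp only [Sigma.mk.injEq, heq_eq_eq, and_true]
    omega
  · rintro ⟨k, r⟩ h
    simp
  · rintro ⟨r, k⟩ h
    simp only [Finset.mem_sigma, Finset.mem_range] at h
    have hc : (n.choose r * r.descFactorial k : R) =
        n.descFactorial k * (n - k).choose (r - k) := by
      exact_mod_cast congrArg (Nat.cast : ℕ → R)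
        (choose_mul_descFactorial (n := n) (r := r) (k := k) (by omega))
    have he : n - k - (r - k) = n - r := by omega
    simp only [nsmul_eq_mul, he]
    linear_combination (j (k + 1) * d (r - k) * y ^ (n - r)) * hc

lemma det_Jmat_update {R : Type*} [CommRing R] (j : ℕ → R) (y : R) (n : ℕ) :
    (Jmat (Function.update j 1 (j 1 + y)) n).det =
      ∑ r ∈ Finset.range (n + 1), n.choose r • ((Jmat j r).det * y ^ (n - r)) := by
  induction n using Nat.strong_induction_on with
  | _ n ih =>
    cases n with
    | zero => simp
    | succ n =>
      rw [binomial_transform_succ j (fun r => (Jmat j r).det) y (det_Jmat_succ j), det_Jmat_succ]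
      simp only [← ih n (by omega)]
      have hk : ∀ k, ∑ r ∈ Finset.range (n - k + 1),
          (n - k).choose r • ((Jmat j r).det * y ^ (n - k - r)) =
          (Jmat (Function.update j 1 (j 1 + y)) (n - k)).det :=
        fun k => (ih (n - k) (by omega)).symm
      simp only [hk]
      rw [Finset.sum_range_succ', Finset.sum_range_succ' _ n]
      simp
      ring

lemma Jmat_map_C_sub {R : Type*} [CommRing R] (j : ℕ → R) (n : ℕ) :
    (Jmat j n).map Polynomial.C - (Polynomial.X : R[X]) • 1 =
      Jmat (Function.update (fun m => Polynomial.C (j m)) 1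
        (Polynomial.C (j 1) + -Polynomial.X)) n := by
  ext1 i k
  rcases lt_trichotomy (k : ℕ) i with h | h | h
  · have hne : i ≠ k := by rintro rfl; omega
    have h' : (i : ℕ) - k ≠ 0 := by omega
    have hle : k ≤ i := h.le
    simp [Jmat, hle, hne, h', Function.update_apply]
  · obtain rfl := Fin.ext h
    simp [Jmat, sub_eq_add_neg]
  · have hne : i ≠ k := by rintro rfl; omega
    simp only [Jmat, Matrix.sub_apply, Matrix.map_apply, Matrix.of_apply, Matrix.smul_apply,
      Matrix.one_apply_ne hne, smul_zero, sub_zero, if_neg h.not_ge]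
    split_ifs <;> simp

lemma det_Jmat_C {R : Type*} [CommRing R] (j : ℕ → R) (n : ℕ) :
    (Jmat (fun m => Polynomial.C (j m)) n).det = Polynomial.C (Jmat j n).det := by
  rw [RingHom.map_det]
  congr 1
  ext1 i k
  simp only [Jmat, RingHom.mapMatrix_apply, Matrix.map_apply, Matrix.of_apply]
  split_ifs <;> simp

/-- Vein–Dale restated for `J_n(j̄)`: in `R[x]`,
`det (J_n(j̄) - x • I) = ∑_{r=0}^n C(n,r) • (det (J_r(j̄)) * (-1)^(n-r) * x^(n-r))`. -/
theorem veinDale_Jmat {R : Type*} [CommRing R] (j : ℕ → R) (n : ℕ) (hn : 1 ≤ n) :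
    ((Jmat j n).map Polynomial.C - (Polynomial.X : R[X]) • 1).det =
      ∑ r ∈ Finset.range (n + 1),
        (n.choose r) • (Polynomial.C ((Jmat j r).det) * (-1 : R[X]) ^ (n - r) *
          (Polynomial.X : R[X]) ^ (n - r)) := by
  rw [Jmat_map_C_sub, det_Jmat_update]
  refine Finset.sum_congr rfl fun r _ => ?_
  rw [det_Jmat_C, neg_pow, mul_assoc]
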